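/- (Schur's Lemma) In the space ℓ¹ of absolutely summable real sequences with the norm ‖x‖₁ = ∑ |x(n)|, a sequence (x_n) converges weakly to x if and only if it converges to x in norm; that is, x_n →ʷ x if and only if ‖x_n − x‖₁ → 0. -/

import Mathlib

open Filter Topology

/-- The real sign attached to a Boolean: `1` for `true` and `-1` for `false`. -/
def boolSign (b : Bool) : ℝ := if b then 1 else -1

theorem abs_boolSign (b : Bool) : |boolSign b| = 1 := by
  cases b <;> simp [boolSign]

theorem abs_boolSign_mul (b : Bool) (r : ℝ) : |boolSign b * r| = |r| := by
  rw [abs_mul, abs_boolSign, one_mul]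

theorem boolSign_decide_mul (r : ℝ) : boolSign (decide (0 ≤ r)) * r = |r| := by
  by_cases h : 0 ≤ r
  · simp [boolSign, h, abs_of_nonneg h]
  · simp [boolSign, h, abs_of_neg (not_le.mp h)]

namespace lp

theorem hasSum_abs_one {α : Type*} (y : lp (fun _ : α => ℝ) 1) :
    HasSum (fun k => |y k|) ‖y‖ := by
  simpa using lp.hasSum_norm (p := 1) (by simp) y

theorem summable_boolSign_mul {α : Type*} (s : α → Bool) (y : lp (fun _ : α => ℝ) 1) :
    Summable fun k => boolSign (s k) * y k :=
  .of_abs <| by simpa only [abs_boolSign_mul] using (hasSum_abs_one y).summable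

/-- The continuous linear functional on `ℓ¹` pairing with a sequence of signs. -/
noncomputable def signedSumCLM {α : Type*} (s : α → Bool) :
    lp (fun _ : α => ℝ) 1 →L[ℝ] ℝ :=
  LinearMap.mkContinuous
    { toFun := fun y => ∑' k, boolSign (s k) * y k
      map_add' := fun y z => by
        rw [← (summable_boolSign_mul s y).tsum_add (summable_boolSign_mul s z)]
        exact tsum_congr fun k => by simp [mul_add]
      map_smul' := fun c y => by
        rw [RingHom.id_apply, smul_eq_mul, ← tsum_mul_left]
        exact tsum_congr fun k => by simp [mul_left_comm] }
    1 fun y => by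
      rw [one_mul]
      refine tsum_of_norm_bounded (hasSum_abs_one y) fun k => ?_
      rw [Real.norm_eq_abs, abs_boolSign_mul]

theorem signedSumCLM_apply {α : Type*} (s : α → Bool) (y : lp (fun _ : α => ℝ) 1) :
    signedSumCLM s y = ∑' k, boolSign (s k) * y k := rfl

theorem continuous_signedSumCLM_apply {α : Type*} (y : lp (fun _ : α => ℝ) 1) :
    Continuous fun s : α → Bool => signedSumCLM s y := by
  simp only [signedSumCLM_apply]
  refine continuous_tsum (u := fun k => |y k|) (fun k => ?_) (hasSum_abs_one y).summable
    fun k s => ?_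
  · exact ((continuous_of_discreteTopology (f := boolSign)).comp (continuous_apply k)).mul
      continuous_const
  · rw [Real.norm_eq_abs, abs_boolSign_mul]

/-- Choosing the signs of `y` outside a finite set `I` recovers `‖y‖` up to the mass on `I`. -/
theorem norm_le_signedSumCLM_add {α : Type*} [DecidableEq α] (s : α → Bool) (I : Finset α)
    (y : lp (fun _ : α => ℝ) 1) :
    ‖y‖ ≤ signedSumCLM (fun k => if k ∈ I then s k else decide (0 ≤ y k)) y
      + 2 * ∑ k ∈ I, |y k| := by
  have hI : HasSum (fun k => if k ∈ I then 2 * |y k| else 0) (2 * ∑ k ∈ I, |y k|) := by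
    rw [Finset.mul_sum]
    rw [← Finset.sum_congr rfl fun k hk => if_pos (c := k ∈ I) (e := (0 : ℝ)) hk]
    exact hasSum_sum_of_ne_finset_zero fun k hk => if_neg hk
  refine hasSum_le (fun k => ?_) (hasSum_abs_one y)
    ((summable_boolSign_mul (fun k => if k ∈ I then s k else decide (0 ≤ y k)) y).hasSum.add hI)
  by_cases hk : k ∈ I
  · simp only [hk, if_true]
    have := neg_abs_le (boolSign (s k) * y k)
    rw [abs_boolSign_mul] at this
    linarith
  · simp only [hk, if_false, boolSign_decide_mul, add_zero, le_refl]

/-- A weakly null sequence in `ℓ¹` is norm null, by the Baire category theorem on the compact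
space of sign sequences. -/
theorem tendsto_norm_zero_of_weakly_null {α : Type*} (y : ℕ → lp (fun _ : α => ℝ) 1)
    (hy : ∀ f : lp (fun _ : α => ℝ) 1 →L[ℝ] ℝ, Tendsto (fun n => f (y n)) atTop (𝓝 0)) :
    Tendsto (fun n => ‖y n‖) atTop (𝓝 0) := by
  classical
  rw [Metric.tendsto_atTop]
  intro ε hε
  let F : ℕ → Set (α → Bool) := fun N => ⋂ n ≥ N, {s | |signedSumCLM s (y n)| ≤ ε / 2}
  have hF : ∀ N, IsClosed (F N) := fun N =>
    isClosed_biInter fun n _ =>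
      isClosed_le (continuous_signedSumCLM_apply (y n)).abs continuous_const
  have hU : ⋃ N, F N = Set.univ := by
    refine Set.eq_univ_of_forall fun s => ?_
    obtain ⟨N, hN⟩ := Metric.tendsto_atTop.mp (hy (signedSumCLM s)) (ε / 2) (half_pos hε)
    refine Set.mem_iUnion.mpr ⟨N, Set.mem_iInter₂.mpr fun n hn => ?_⟩
    simpa [Real.dist_eq] using (hN n hn).le
  obtain ⟨N, s, hs⟩ := nonempty_interior_of_iUnion_of_closed hF hU
  obtain ⟨I, u, hu, hsub⟩ := isOpen_pi_iff.mp isOpen_interior s hs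
  have hcoord : Tendsto (fun n => 2 * ∑ k ∈ I, |y n k|) atTop (𝓝 0) := by
    have h := (tendsto_finsetSum I fun k _ =>
      (hy (lp.evalCLM ℝ (fun _ : α => ℝ) 1 k)).abs).const_mul 2
    simp only [abs_zero, Finset.sum_const_zero, mul_zero] at h
    exact h
  obtain ⟨M, hM⟩ := Metric.tendsto_atTop.mp hcoord (ε / 2) (half_pos hε)
  refine ⟨max N M, fun n hn => ?_⟩
  have hmem : (fun k => if k ∈ I then s k else decide (0 ≤ y n k)) ∈ F N := by
    refine interior_subset (hsub fun k hk => ?_)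
    simpa only [Finset.mem_coe.mp hk, if_true] using (hu k hk).2
  have h₁ := Set.mem_iInter₂.mp hmem n ((le_max_left _ _).trans hn)
  rw [Set.mem_ofPred_eq] at h₁
  have h₂ := hM n ((le_max_right _ _).trans hn)
  rw [Real.dist_eq, sub_zero] at h₂ ⊢
  rw [abs_of_nonneg (norm_nonneg _)]
  linarith [norm_le_signedSumCLM_add s I (y n), (abs_le.mp h₁).2, (abs_lt.mp h₂).2]

end lp

/-- (Schur's Lemma) In `ℓ¹`, the space of absolutely summable real sequences
with the norm `‖x‖₁ = ∑ |x n|`, a sequence `(xₙ)` converges weakly to `x₀`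
(i.e. `f xₙ → f x₀` for every continuous linear functional `f`) if and only
if it converges to `x₀` in norm. -/
theorem schur_lemma_l1
    (x : ℕ → lp (fun _ : ℕ => ℝ) 1) (x₀ : lp (fun _ : ℕ => ℝ) 1) :
    (∀ f : lp (fun _ : ℕ => ℝ) 1 →L[ℝ] ℝ,
        Tendsto (fun n => f (x n)) atTop (𝓝 (f x₀))) ↔
      Tendsto (fun n => ‖x n - x₀‖) atTop (𝓝 0) := by
  constructor
  · intro h
    refine lp.tendsto_norm_zero_of_weakly_null (fun n => x n - x₀) fun f => ?_
    simpa only [map_sub, sub_self] using (h f).sub_const (f x₀)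
  · intro h f
    exact (f.continuous.tendsto x₀).comp (tendsto_iff_norm_sub_tendsto_zero.mpr h)
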